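/- arXiv:1208.5463 — 2 statements merged into one kernel-verified Lean document; each statement's English description precedes it below -/
import Mathlib

section
/- For each rational number t with 0 < t < 9/4, there exists a finite simple graph G which is nonhamiltonian and has toughness τ(G) = t. -/
open SimpleGraph

/-- Number of connected components of the subgraph induced on the complement of `S`. -/
noncomputable def numComponents {V : Type} (G : SimpleGraph V) (S : Set V) : ℕ :=
  Nat.card (G.induce Sᶜ).ConnectedComponent

/-- `G` is `t`-tough: `|S| ≥ t · ω(G \ S)` for every vertex subset `S`
with `ω(G \ S) > 1`. -/
def IsTough {V : Type} (t : ℝ) (G : SimpleGraph V) : Prop :=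
  ∀ S : Finset V, 1 < numComponents G ↑S →
    t * (numComponents G ↑S : ℝ) ≤ (S.card : ℝ)

/-- The toughness of `G` equals `t`: `t` is the greatest nonnegative real
for which `G` is `t`-tough. -/
def HasToughness {V : Type} (G : SimpleGraph V) (t : ℝ) : Prop :=
  IsGreatest {s : ℝ | 0 ≤ s ∧ IsTough s G} t

/-- A Hamiltonian cycle: a cycle whose support contains every vertex. -/
def IsHamCycle {V : Type} {G : SimpleGraph V} {v : V} (p : G.Walk v v) : Prop :=
  p.IsCycle ∧ ∀ u, u ∈ p.support

/-- A graph is Hamiltonian if it contains a Hamiltonian cycle. -/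
def IsHam {V : Type} (G : SimpleGraph V) : Prop :=
  ∃ (v : V) (p : G.Walk v v), IsHamCycle p

/-- `x` and `y` are connected by a Hamilton path of `G`: a path with endpoints
`x` and `y` containing every vertex of `G`. -/
def HamConnected {V : Type} (G : SimpleGraph V) (x y : V) : Prop :=
  ∃ p : G.Walk x y, p.IsPath ∧ ∀ v, v ∈ p.support

/-- `y` can be reached from `x` by a walk of `G` all of whose vertices after `x` avoid `S`. -/
def ReachOff {V : Type} (G : SimpleGraph V) (S : Set V) : V → V → Prop :=
  Relation.ReflTransGen fun a b => G.Adj a b ∧ b ∉ S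

theorem ReachOff.reachable {V : Type} {G : SimpleGraph V} {S : Set V} {x y : V}
    (h : ReachOff G S x y) (hx : x ∈ Sᶜ) :
    ∃ hy : y ∈ Sᶜ, (G.induce Sᶜ).Reachable ⟨x, hx⟩ ⟨y, hy⟩ := by
  induction h with
  | refl => exact ⟨hx, .refl _⟩
  | tail _ hbc ih =>
    obtain ⟨hb, hr⟩ := ih
    exact ⟨hbc.2, hr.trans (Adj.reachable (by simpa using hbc.1))⟩

theorem numComponents_le_card {V : Type} {G : SimpleGraph V} {S : Set V} (D : Finset V)
    (hD : ∀ d ∈ D, d ∉ S) (h : ∀ v ∉ S, ∃ d ∈ D, ReachOff G S d v) :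
    numComponents G S ≤ D.card := by
  have hsurj : Function.Surjective (fun d : D =>
      (G.induce Sᶜ).connectedComponentMk ⟨d.1, hD d.1 d.2⟩) := by
    intro C
    induction C using ConnectedComponent.ind with
    | h v =>
      obtain ⟨d, hd, hr⟩ := h v.1 v.2
      exact ⟨⟨d, hd⟩, ConnectedComponent.sound (hr.reachable (hD d hd)).2⟩
  simpa [numComponents] using Nat.card_le_card_of_surjective _ hsurj

theorem card_add_one_le_numComponents {V : Type} [Finite V] {G : SimpleGraph V} {S : Set V}
    (Z : Finset V) (hZ : ∀ z ∈ Z, z ∉ S) (hiso : ∀ z ∈ Z, ∀ y, G.Adj z y → y ∈ S)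
    {v : V} (hvS : v ∉ S) (hvZ : v ∉ Z) : Z.card + 1 ≤ numComponents G S := by
  have key : ∀ (z w : ↥Sᶜ), z.1 ∈ Z → (G.induce Sᶜ).Reachable z w → z.1 = w.1 := by
    rintro z w hz ⟨p⟩
    cases p with
    | nil => rfl
    | @cons _ u _ hadj _ => exact absurd (hiso _ hz u.1 (by simpa using hadj)) u.2
  let f : Option Z → (G.induce Sᶜ).ConnectedComponent
    | none => (G.induce Sᶜ).connectedComponentMk ⟨v, hvS⟩
    | some z => (G.induce Sᶜ).connectedComponentMk ⟨z.1, hZ z.1 z.2⟩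
  have hf : Function.Injective f := by
    rintro (_ | ⟨z, hz⟩) (_ | ⟨w, hw⟩) h
    · rfl
    · exact absurd (key ⟨w, hZ w hw⟩ ⟨v, hvS⟩ hw (ConnectedComponent.exact h).symm)
        (fun e => hvZ ((show w = v from e) ▸ hw))
    · exact absurd (key ⟨z, hZ z hz⟩ ⟨v, hvS⟩ hz (ConnectedComponent.exact h))
        (fun e => hvZ ((show z = v from e) ▸ hz))
    · have := key ⟨z, hZ z hz⟩ ⟨w, hZ w hw⟩ hz (ConnectedComponent.exact h)
      simp_all
  simpa [numComponents] using Nat.card_le_card_of_injective f hf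

/-- The join of a complete graph on `T` with the graph obtained from disjoint copies of the
gadgets `H i` by making all terminals (the vertices in the sets `A i`) pairwise adjacent. -/
def glue (T : Type) {ι W : Type} (H : ι → SimpleGraph W) (A : ι → Finset W) :
    SimpleGraph (T ⊕ ι × W) where
  Adj
    | .inl a, .inl b => a ≠ b
    | .inl _, .inr _ => True
    | .inr _, .inl _ => True
    | .inr p, .inr q =>
      (p.1 = q.1 ∧ (H p.1).Adj p.2 q.2) ∨ (p.2 ∈ A p.1 ∧ q.2 ∈ A q.1 ∧ p ≠ q)
  symm := ⟨by
    rintro (a | ⟨i, x⟩) (b | ⟨k, y⟩) h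
    · exact Ne.symm h
    · trivial
    · trivial
    · rcases h with ⟨rfl, h⟩ | ⟨h1, h2, h3⟩
      · exact .inl ⟨rfl, h.symm⟩
      · exact .inr ⟨h2, h1, h3.symm⟩⟩
  loopless := ⟨by
    rintro (a | ⟨i, x⟩) h
    · exact h rfl
    · rcases h with ⟨_, h⟩ | ⟨_, _, h⟩
      · exact h.ne rfl
      · exact h rfl⟩

/-- Removing any vertex set `S` from the gadget leaves at most `c` components without terminals,
and each of them costs at least `s` vertices of `S`. -/
def IsSparse {W : Type} [DecidableEq W] (H : SimpleGraph W) (A : Finset W) (c s : ℕ) : Prop :=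
  ∀ S : Finset W, ∃ R : Finset W, R.card ≤ c ∧ s * R.card ≤ S.card ∧ Disjoint R S ∧
    ∀ y ∉ S, ∃ x ∈ R ∪ (A \ S), ReachOff H S x y

/-- At most `s * k` vertices of the gadget, not all the terminals among them, isolate `k`
nonterminals. -/
def IsTight {W : Type} (H : SimpleGraph W) (A : Finset W) (s k : ℕ) : Prop :=
  ∃ S Z : Finset W, S.card ≤ s * k ∧ Z.card = k ∧ Disjoint Z S ∧ Disjoint Z A ∧
    (∀ z ∈ Z, ∀ y, H.Adj z y → y ∈ S) ∧ ∃ x ∈ A, x ∉ S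

/-- The subset of `ι × W` whose slice over `i` is `S i`. -/
def spread {ι W : Type} [Fintype ι] [Fintype W] [DecidableEq W] (S : ι → Finset W) :
    Finset (ι × W) :=
  Finset.univ.filter fun p => p.2 ∈ S p.1

theorem mem_spread {ι W : Type} [Fintype ι] [Fintype W] [DecidableEq W] {S : ι → Finset W}
    {p : ι × W} : p ∈ spread S ↔ p.2 ∈ S p.1 := by
  simp [spread]

theorem card_spread {ι W : Type} [Fintype ι] [Fintype W] [DecidableEq W]
    (S : ι → Finset W) : (spread S).card = ∑ i, (S i).card := by
  have : spread S = (Finset.univ.sigma S).map (Equiv.sigmaEquivProd ι W).toEmbedding := by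
    ext ⟨i, x⟩
    simp [spread, Finset.mem_map_equiv]
  rw [this, Finset.card_map, Finset.card_sigma]

section Glue

variable {T ι W : Type} {H : ι → SimpleGraph W} {A : ι → Finset W}

theorem numComponents_glue_le_one {S : Set (T ⊕ ι × W)} {a : T} (ha : Sum.inl a ∉ S) :
    numComponents (glue T H A) S ≤ 1 := by
  refine (numComponents_le_card {Sum.inl a} (by simpa using ha) fun v hv => ?_).trans (by simp)
  refine ⟨_, Finset.mem_singleton_self _, ?_⟩
  by_cases h : v = Sum.inl a
  · rw [h]
    exact .refl
  · refine .single ⟨?_, hv⟩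
    rcases v with b | p
    · exact fun e => h (by rw [e])
    · trivial

theorem numComponents_glue_le [Fintype ι] [Fintype W] [DecidableEq T] [DecidableEq ι]
    [DecidableEq W] {S : Finset (T ⊕ ι × W)} (hT : ∀ a, Sum.inl a ∈ S) {Q R : ι → Finset W}
    (hQ : ∀ i x, x ∈ Q i ↔ Sum.inr (i, x) ∈ S) (hdisj : ∀ i, Disjoint (R i) (Q i))
    (hR : ∀ i, ∀ y ∉ Q i, ∃ x ∈ R i ∪ (A i \ Q i), ReachOff (H i) (Q i) x y) :
    numComponents (glue T H A) S ≤ 1 + ∑ i, (R i).card := by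
  obtain ⟨D, hD1, hDS, hD⟩ : ∃ D : Finset (T ⊕ ι × W), D.card ≤ 1 ∧ (∀ d ∈ D, d ∉ S) ∧
      ∀ i, ∀ x ∈ A i, x ∉ Q i → ∃ d ∈ D, ReachOff (glue T H A) S d (Sum.inr (i, x)) := by
    by_cases h : ∃ i, ∃ x ∈ A i, x ∉ Q i
    · obtain ⟨i, x, hx, hxQ⟩ := h
      refine ⟨{Sum.inr (i, x)}, by simp, by simpa [hQ] using hxQ, fun k y hy hyQ =>
        ⟨_, Finset.mem_singleton_self _, ?_⟩⟩
      by_cases e : (i, x) = (k, y)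
      · rw [e]
        exact .refl
      · exact .single ⟨.inr ⟨hx, hy, e⟩, by simpa [hQ] using hyQ⟩
    · push Not at h
      exact ⟨∅, by simp, by simp, fun i x hx hxQ => absurd (h i x hx) hxQ⟩
  refine (numComponents_le_card (D ∪ (spread R).map Function.Embedding.inr) ?_ ?_).trans ?_
  · intro d hd
    rcases Finset.mem_union.1 hd with hd | hd
    · exact hDS d hd
    · obtain ⟨⟨i, x⟩, hx, rfl⟩ := Finset.mem_map.1 hd
      exact fun hS => Finset.disjoint_left.1 (hdisj i) (mem_spread.1 hx) ((hQ i x).2 hS)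
  · rintro (a | ⟨i, y⟩) hv
    · exact absurd (hT a) hv
    · have hy : y ∉ Q i := fun h => hv ((hQ i y).1 h)
      obtain ⟨x, hx, hr⟩ := hR i y hy
      have hr' : ReachOff (glue T H A) S (Sum.inr (i, x)) (Sum.inr (i, y)) :=
        hr.lift (fun z => Sum.inr (i, z)) fun u w huw =>
          ⟨.inl ⟨rfl, huw.1⟩, fun h => huw.2 ((hQ i w).2 h)⟩
      rcases Finset.mem_union.1 hx with hx | hx
      · exact ⟨Sum.inr (i, x), Finset.mem_union_right _ (Finset.mem_map_of_mem _
          (mem_spread.2 hx)), hr'⟩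
      · obtain ⟨hxA, hxQ⟩ := Finset.mem_sdiff.1 hx
        obtain ⟨d, hd, hdr⟩ := hD i x hxA hxQ
        exact ⟨d, Finset.mem_union_left _ hd, hdr.trans hr'⟩
  · refine (Finset.card_union_le _ _).trans ?_
    rw [Finset.card_map, card_spread]
    omega

theorem isTough_glue [Fintype T] [Fintype ι] [Fintype W] [DecidableEq T] [DecidableEq ι]
    [DecidableEq W] {c s k : ι → ℕ} {t : ℝ}
    (hsparse : ∀ i, IsSparse (H i) (A i) (c i) (s i)) (ht : 0 ≤ t)
    (hk : ∀ i, ∀ r ≤ c i, t * ((r : ℝ) - k i) ≤ s i * ((r : ℝ) - k i))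
    (heq : t * (1 + ∑ i, (k i : ℝ)) = Fintype.card T + ∑ i, (s i : ℝ) * k i) :
    IsTough t (glue T H A) := by
  intro S hS
  by_cases hT : ∀ a, Sum.inl a ∈ S
  · let Q : ι → Finset W := fun i => Finset.univ.filter fun x => Sum.inr (i, x) ∈ S
    have hQ : ∀ i x, x ∈ Q i ↔ Sum.inr (i, x) ∈ S := by simp [Q]
    choose R hRc hRs hRd hR using fun i => hsparse i (Q i)
    have hcomp := numComponents_glue_le hT hQ hRd hR
    have hcard : Fintype.card T + ∑ i, s i * (R i).card ≤ S.card := by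
      have hsub : (Finset.univ : Finset T).disjSum (spread Q) ⊆ S := by
        rintro (a | ⟨i, x⟩) h
        · exact hT a
        · exact (hQ i x).1 (mem_spread.1 (Finset.inr_mem_disjSum.1 h))
      have := Finset.card_le_card hsub
      rw [Finset.card_disjSum, card_spread, Finset.card_univ] at this
      exact (Nat.add_le_add_left (Finset.sum_le_sum fun i _ => hRs i) _).trans this
    have hsum : ∑ i, t * (((R i).card : ℝ) - k i) ≤ ∑ i, s i * (((R i).card : ℝ) - k i) :=
      Finset.sum_le_sum fun i _ => hk i _ (hRc i)
    simp only [mul_sub, Finset.sum_sub_distrib, ← Finset.mul_sum] at hsum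
    have hcomp' : (numComponents (glue T H A) S : ℝ) ≤ 1 + ∑ i, ((R i).card : ℝ) := by
      exact_mod_cast hcomp
    have hcard' : (Fintype.card T : ℝ) + ∑ i, (s i : ℝ) * (R i).card ≤ S.card := by
      exact_mod_cast hcard
    have := mul_le_mul_of_nonneg_left hcomp' ht
    linarith
  · push Not at hT
    obtain ⟨a, ha⟩ := hT
    exact absurd hS (numComponents_glue_le_one (by simpa using ha)).not_gt

theorem hasToughness_glue [Nonempty ι] [Fintype T] [Fintype ι] [Fintype W] [DecidableEq T]
    [DecidableEq ι] [DecidableEq W] {c s k : ι → ℕ} {t : ℝ}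
    (hsparse : ∀ i, IsSparse (H i) (A i) (c i) (s i))
    (htight : ∀ i, IsTight (H i) (A i) (s i) (k i)) (ht : 0 ≤ t)
    (hk : ∀ i, ∀ r ≤ c i, t * ((r : ℝ) - k i) ≤ s i * ((r : ℝ) - k i))
    (hpos : 0 < ∑ i, k i)
    (heq : t * (1 + ∑ i, (k i : ℝ)) = Fintype.card T + ∑ i, (s i : ℝ) * k i) :
    HasToughness (glue T H A) t := by
  refine ⟨⟨ht, isTough_glue hsparse ht hk heq⟩, ?_⟩
  rintro u ⟨hu, htough⟩
  choose Q Z hQ hZ hdQ hdA hiso hx using htight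
  obtain ⟨x, hxA, hxQ⟩ := hx (Classical.arbitrary ι)
  have hcomp := card_add_one_le_numComponents (G := glue T H A)
    (S := ((Finset.univ : Finset T).disjSum (spread Q) : Finset _))
    ((spread Z).map Function.Embedding.inr) (v := Sum.inr (Classical.arbitrary ι, x))
    (by
      rintro _ hz
      obtain ⟨⟨i, z⟩, hp, rfl⟩ := Finset.mem_map.1 hz
      simpa [mem_spread] using Finset.disjoint_left.1 (hdQ i) (mem_spread.1 hp))
    (by
      rintro _ hz y hadj
      obtain ⟨⟨i, z⟩, hp, rfl⟩ := Finset.mem_map.1 hz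
      replace hp := mem_spread.1 hp
      rcases y with a | ⟨j, y⟩
      · simp
      · rcases hadj with ⟨e, h⟩ | ⟨h, -, -⟩
        · obtain rfl : i = j := e
          simpa [mem_spread] using hiso i z hp y h
        · exact absurd h (Finset.disjoint_left.1 (hdA i) hp))
    (by simpa [mem_spread] using hxQ)
    (by
      simp only [Finset.mem_map, not_exists, not_and]
      rintro ⟨i, z⟩ hz e
      obtain ⟨rfl, rfl⟩ : i = Classical.arbitrary ι ∧ z = x := by simpa using e
      exact Finset.disjoint_left.1 (hdA _) (mem_spread.1 hz) hxA)
  rw [Finset.card_map, card_spread, Finset.sum_congr rfl fun i _ => hZ i] at hcomp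
  have hle := htough _ (lt_of_lt_of_le (Nat.succ_lt_succ hpos) hcomp)
  rw [Finset.card_disjSum, card_spread, Finset.card_univ] at hle
  have hsum : ∑ i, (Q i).card ≤ ∑ i, s i * k i := Finset.sum_le_sum fun i _ => hQ i
  have hsum' : (∑ i, ((Q i).card : ℝ)) ≤ ∑ i, (s i : ℝ) * k i := by exact_mod_cast hsum
  have hcomp' : ∑ i, (k i : ℝ) + 1 ≤ (numComponents (glue T H A)
      ((Finset.univ : Finset T).disjSum (spread Q) : Finset _) : ℝ) := by exact_mod_cast hcomp
  have hmul := mul_le_mul_of_nonneg_left hcomp' hu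
  push_cast at hle
  have hpos' : (0 : ℝ) < 1 + ∑ i, (k i : ℝ) := by positivity
  refine le_of_mul_le_mul_right ?_ hpos'
  linarith

end Glue

/-- The set of vertices reached from `X` by walks of length at most `k` avoiding `S` after their
start. -/
def ballOff {W : Type} [Fintype W] [DecidableEq W] (H : SimpleGraph W) [DecidableRel H.Adj]
    (S X : Finset W) : ℕ → Finset W
  | 0 => X
  | k + 1 =>
    let Y := ballOff H S X k
    Finset.univ.filter fun y => y ∉ S ∧ (y ∈ Y ∨ ∃ z ∈ Y, H.Adj z y)

theorem exists_reachOff_of_mem_ballOff {W : Type} [Fintype W] [DecidableEq W]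
    {H : SimpleGraph W} [DecidableRel H.Adj] {S X : Finset W} {k : ℕ} {y : W}
    (hy : y ∈ ballOff H S X k) : ∃ x ∈ X, ReachOff H S x y := by
  induction k generalizing y with
  | zero => exact ⟨y, hy, .refl⟩
  | succ k ih =>
    obtain ⟨hyS, hy | ⟨z, hz, hzy⟩⟩ := (Finset.mem_filter.1 hy).2
    · exact ih hy
    · obtain ⟨x, hx, hr⟩ := ih hz
      exact ⟨x, hx, hr.tail ⟨hzy, by simpa using hyS⟩⟩

/-- The relation generating the edges of the 4-cycle `0, 1, 2, 3` together with, for each of its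
edges, a further vertex adjacent to both ends. -/
def sunRel (x y : Fin 8) : Bool :=
  (x, y) ∈ [(0, 1), (1, 2), (2, 3), (3, 0), (4, 0), (4, 1), (5, 1), (5, 2), (6, 2), (6, 3),
    (7, 3), (7, 0)]

/-- The 4-cycle with a triangle erected on each edge. -/
def sunGraph : SimpleGraph (Fin 8) := SimpleGraph.fromRel fun x y => sunRel x y

instance : DecidableRel sunGraph.Adj := fun x y =>
  inferInstanceAs (Decidable (x ≠ y ∧ (sunRel x y ∨ sunRel y x)))

theorem isSparse_sunGraph : IsSparse sunGraph {4, 6} 2 2 := by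
  have key : ∀ S : Finset (Fin 8),
      ∃ R ∈ [∅, {0}, {1}, {2}, {3}, {5}, {7}, {0, 2}, {1, 3}, {5, 7}, {0, 5}, {3, 5}, {1, 7},
        {2, 7}], R.card ≤ 2 ∧ 2 * R.card ≤ S.card ∧ Disjoint R S ∧
        S ∪ ballOff sunGraph S (R ∪ ({4, 6} \ S)) 3 = Finset.univ := by
    decide +kernel
  intro S
  obtain ⟨R, -, h1, h2, h3, h4⟩ := key S
  refine ⟨R, h1, h2, h3, fun y hy => exists_reachOff_of_mem_ballOff (k := 3) ?_⟩
  exact (Finset.mem_union.1 (h4 ▸ Finset.mem_univ y)).resolve_left hy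

theorem isTight_sunGraph : IsTight sunGraph {4, 6} 2 2 :=
  ⟨{0, 1, 2, 3}, {5, 7}, by decide +kernel⟩

/-- The star with centre `0` and leaves `1, …, s`, together with isolated vertices. -/
def pendantGraph (s : ℕ) : SimpleGraph (Fin 8) :=
  SimpleGraph.fromRel fun x y => x = 0 ∧ y.val ≤ s

instance (s : ℕ) : DecidableRel (pendantGraph s).Adj := fun x y =>
  inferInstanceAs (Decidable (x ≠ y ∧ ((x = 0 ∧ y.val ≤ s) ∨ (y = 0 ∧ x.val ≤ s))))

theorem isSparse_pendantGraph {s : ℕ} (hs : s ≤ 2) : IsSparse (pendantGraph s) {0}ᶜ 1 s := by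
  have key : ∀ s ≤ 2, ∀ S : Finset (Fin 8), ∃ R ∈ [∅, {0}], R.card ≤ 1 ∧ s * R.card ≤ S.card ∧
      Disjoint R S ∧ S ∪ ballOff (pendantGraph s) S (R ∪ ({0}ᶜ \ S)) 1 = Finset.univ := by
    decide +kernel
  intro S
  obtain ⟨R, -, h1, h2, h3, h4⟩ := key s hs S
  refine ⟨R, h1, h2, h3, fun y hy => exists_reachOff_of_mem_ballOff (k := 1) ?_⟩
  exact (Finset.mem_union.1 (h4 ▸ Finset.mem_univ y)).resolve_left hy

theorem isTight_pendantGraph {s : ℕ} (hs : s ≤ 2) : IsTight (pendantGraph s) {0}ᶜ s 1 := by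
  refine ⟨({1, 2} : Finset (Fin 8)).filter fun x => x.val ≤ s, {0}, ?_⟩
  revert s
  decide +kernel

theorem IsHam.exists_perm {V : Type} [Finite V] {G : SimpleGraph V} (h : IsHam G) :
    ∃ σ : Equiv.Perm V, (∀ v, G.Adj v (σ v)) ∧
      ∀ X : Set V, X.Nonempty → (∀ v ∈ X, σ v ∈ X) → X = Set.univ := by
  obtain ⟨u, p, hp, hsupp⟩ := h
  have hlen : 0 < p.length := by have := hp.three_le_length; omega
  have hidx : ∀ v, ∃ k < p.length, p.getVert k = v := by
    intro v
    obtain ⟨k, hk, hkl⟩ := Walk.mem_support_iff_exists_getVert.1 (hsupp v)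
    rcases hkl.lt_or_eq with hlt | rfl
    · exact ⟨k, hlt, hk⟩
    · exact ⟨0, hlen, by simpa using hk⟩
  choose idx hlt hidx using hidx
  have hinj : Function.Injective fun v => p.getVert (idx v + 1) := by
    intro v w h
    have := hp.getVert_injOn (by have := hlt v; simp; omega) (by have := hlt w; simp; omega) h
    rw [← hidx v, ← hidx w, Nat.succ_injective this]
  have hnext : ∀ k < p.length, p.getVert (idx (p.getVert k) + 1) = p.getVert (k + 1) := by
    intro k hk
    have := hp.getVert_injOn' (by have := hlt (p.getVert k); simp; omega) (by simp; omega)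
      (hidx (p.getVert k))
    rw [this]
  refine ⟨Equiv.ofBijective _ (Finite.injective_iff_bijective.1 hinj), fun v => ?_, ?_⟩
  · have := p.adj_getVert_succ (hlt v)
    rwa [hidx] at this
  · rintro X ⟨v, hv⟩ hX
    have hstep : ∀ k < p.length, p.getVert k ∈ X → p.getVert (k + 1) ∈ X := fun k hk hkX => by
      have := hX _ hkX
      rwa [Equiv.ofBijective_apply, hnext k hk] at this
    have hrun : ∀ a k, a + k ≤ p.length → p.getVert a ∈ X → p.getVert (a + k) ∈ X := by
      intro a k hk ha
      induction k with
      | zero => exact ha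
      | succ k ih => exact hstep (a + k) (by omega) (ih (by omega))
    have hend : p.getVert p.length ∈ X := by
      have := hrun (idx v) (p.length - idx v) (by have := hlt v; omega) (by rwa [hidx])
      rwa [Nat.add_sub_cancel' (hlt v).le] at this
    refine Set.eq_univ_of_forall fun w => ?_
    have := hrun 0 (idx w) (by have := hlt w; omega) (by simpa using hend)
    rwa [Nat.zero_add, hidx] at this

/-- The case of `sunGraph_no_passage` in which the vertex `7` is followed by `0`. -/
theorem sunGraph_no_passage_aux {V : Type} {σ : Equiv.Perm V} {e : Fin 8 → V}
    (he : Function.Injective e)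
    (hclosed : ∀ X : List (Fin 8), X ≠ [] → ¬ ∀ x ∈ X, ∃ y ∈ X, σ (e x) = e y)
    (hnext : ∀ x, x ≠ 4 → x ≠ 6 → ∃ y, sunGraph.Adj x y ∧ σ (e x) = e y)
    (hprev : ∀ x, x ≠ 4 → x ≠ 6 → ∃ y, sunGraph.Adj x y ∧ σ (e y) = e x)
    (h7 : σ (e 7) = e 0) : False := by
  have inj : ∀ {x y z}, σ (e x) = e z → σ (e y) = e z → x = y := fun h1 h2 =>
    he (σ.injective (h1.trans h2.symm))
  have fn : ∀ {x y z}, σ (e x) = e y → σ (e x) = e z → y = z := fun h1 h2 =>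
    he (h1.symm.trans h2)
  have nbr0 : ∀ y, sunGraph.Adj 0 y → y = 1 ∨ y = 3 ∨ y = 4 ∨ y = 7 := by decide
  have nbr1 : ∀ y, sunGraph.Adj 1 y → y = 0 ∨ y = 2 ∨ y = 4 ∨ y = 5 := by decide
  have nbr2 : ∀ y, sunGraph.Adj 2 y → y = 1 ∨ y = 3 ∨ y = 5 ∨ y = 6 := by decide
  have nbr3 : ∀ y, sunGraph.Adj 3 y → y = 0 ∨ y = 2 ∨ y = 6 ∨ y = 7 := by decide
  have nbr5 : ∀ y, sunGraph.Adj 5 y → y = 1 ∨ y = 2 := by decide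
  have nbr7 : ∀ y, sunGraph.Adj 7 y → y = 0 ∨ y = 3 := by decide
  have h3 : σ (e 3) = e 7 := by
    obtain ⟨y, hy, h⟩ := hprev 7 (by decide) (by decide)
    rcases nbr7 y hy with rfl | rfl
    · exact absurd (by simp [*]) (hclosed [0, 7] (by simp))
    · exact h
  have h5 : (σ (e 1) = e 5 ∧ σ (e 5) = e 2) ∨ (σ (e 2) = e 5 ∧ σ (e 5) = e 1) := by
    obtain ⟨y, hy, h⟩ := hprev 5 (by decide) (by decide)
    obtain ⟨z, hz, h'⟩ := hnext 5 (by decide) (by decide)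
    rcases nbr5 y hy with rfl | rfl <;> rcases nbr5 z hz with rfl | rfl
    · exact absurd (by simp [*]) (hclosed [1, 5] (by simp))
    · exact .inl ⟨h, h'⟩
    · exact .inr ⟨h, h'⟩
    · exact absurd (by simp [*]) (hclosed [2, 5] (by simp))
  have h0 : σ (e 0) = e 1 ∨ σ (e 0) = e 4 := by
    obtain ⟨y, hy, h⟩ := hnext 0 (by decide) (by decide)
    rcases nbr0 y hy with rfl | rfl | rfl | rfl
    · exact .inl h
    · exact absurd (by simp [*]) (hclosed [0, 3, 7] (by simp))
    · exact .inr h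
    · exact absurd (inj h h3) (by decide)
  rcases h5 with ⟨h1, h5⟩ | ⟨h2, h5⟩
  · have h1' : σ (e 0) = e 1 ∨ (σ (e 0) = e 4 ∧ σ (e 4) = e 1) := by
      refine h0.imp_right fun h0 => ⟨h0, ?_⟩
      obtain ⟨y, hy, h⟩ := hprev 1 (by decide) (by decide)
      rcases nbr1 y hy with rfl | rfl | rfl | rfl
      · exact absurd (fn h h0) (by decide)
      · exact absurd (by simp [*]) (hclosed [1, 5, 2] (by simp))
      · exact h
      · exact absurd (fn h h5) (by decide)
    have h2 : σ (e 2) = e 3 ∨ (σ (e 2) = e 6 ∧ σ (e 6) = e 3) := by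
      obtain ⟨y, hy, h⟩ := hnext 2 (by decide) (by decide)
      rcases nbr2 y hy with rfl | rfl | rfl | rfl
      · exact absurd (by simp [*]) (hclosed [1, 5, 2] (by simp))
      · exact .inl h
      · exact absurd (inj h h1) (by decide)
      · refine .inr ⟨h, ?_⟩
        obtain ⟨z, hz, h'⟩ := hprev 3 (by decide) (by decide)
        rcases nbr3 z hz with rfl | rfl | rfl | rfl
        · rcases h0 with h0 | h0 <;> exact absurd (fn h' h0) (by decide)
        · exact absurd (fn h' h) (by decide)
        · exact h'
        · exact absurd (fn h' h7) (by decide)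
    rcases h1' with h0 | ⟨h0, h4⟩ <;> rcases h2 with h2 | ⟨h2, h6⟩
    · exact absurd (by simp [*]) (hclosed [0, 1, 5, 2, 3, 7] (by simp))
    · exact absurd (by simp [*]) (hclosed [0, 1, 5, 2, 6, 3, 7] (by simp))
    · exact absurd (by simp [*]) (hclosed [0, 4, 1, 5, 2, 3, 7] (by simp))
    · exact absurd (by simp [*]) (hclosed [0, 4, 1, 5, 2, 6, 3, 7] (by simp))
  · have h0 : σ (e 0) = e 4 := h0.resolve_left fun h => absurd (inj h h5) (by decide)
    obtain ⟨y, hy, h⟩ := hnext 1 (by decide) (by decide)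
    rcases nbr1 y hy with rfl | rfl | rfl | rfl
    · exact absurd (inj h h7) (by decide)
    · exact absurd (by simp [*]) (hclosed [1, 2, 5] (by simp))
    · exact absurd (inj h h0) (by decide)
    · exact absurd (inj h h2) (by decide)

/-- A cyclic permutation moving along edges cannot visit all vertices of a copy of `sunGraph` that
it enters and leaves only at the vertices `4` and `6`. -/
theorem sunGraph_no_passage {V : Type} {σ : Equiv.Perm V} {e : Fin 8 → V}
    (he : Function.Injective e)
    (hclosed : ∀ X : List (Fin 8), X ≠ [] → ¬ ∀ x ∈ X, ∃ y ∈ X, σ (e x) = e y)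
    (hnext : ∀ x, x ≠ 4 → x ≠ 6 → ∃ y, sunGraph.Adj x y ∧ σ (e x) = e y)
    (hprev : ∀ x, x ≠ 4 → x ≠ 6 → ∃ y, sunGraph.Adj x y ∧ σ (e y) = e x) : False := by
  obtain ⟨y, hy, h⟩ := hnext 7 (by decide) (by decide)
  have hy' : y = 0 ∨ y = 3 :=
    (by decide : ∀ y, sunGraph.Adj 7 y → y = 0 ∨ y = 3) y hy
  rcases hy' with rfl | rfl
  · exact sunGraph_no_passage_aux he hclosed hnext hprev h
  · let ρ : Fin 8 → Fin 8 := ![3, 2, 1, 0, 6, 5, 4, 7]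
    have hρ : ∀ x, ρ (ρ x) = x := by decide
    have hadj : ∀ x y, sunGraph.Adj (ρ x) y → sunGraph.Adj x (ρ y) := by decide
    have hne : ∀ x, x ≠ 4 → x ≠ 6 → ρ x ≠ 4 ∧ ρ x ≠ 6 := by decide
    refine sunGraph_no_passage_aux (σ := σ) (e := e ∘ ρ)
      (he.comp (Function.LeftInverse.injective hρ)) (fun X hX hc => ?_) (fun x h4 h6 => ?_)
      (fun x h4 h6 => ?_) h
    · refine hclosed (X.map ρ) (by simpa using hX) fun x hx => ?_
      obtain ⟨z, hz, rfl⟩ := List.mem_map.1 hx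
      obtain ⟨y, hy, hzy⟩ := hc z hz
      exact ⟨ρ y, List.mem_map_of_mem hy, hzy⟩
    · obtain ⟨y, hy, hxy⟩ := hnext (ρ x) (hne x h4 h6).1 (hne x h4 h6).2
      exact ⟨ρ y, hadj x y hy, by simpa [hρ] using hxy⟩
    · obtain ⟨y, hy, hxy⟩ := hprev (ρ x) (hne x h4 h6).1 (hne x h4 h6).2
      exact ⟨ρ y, hadj x y hy, by simpa [hρ] using hxy⟩

/-- If there are more than twice as many copies of `sunGraph` as vertices in `T`, then some copy
is entered and left only at its terminals by any Hamiltonian cycle. -/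
theorem not_isHam_glue {T ι κ : Type} [Fintype T] [Nonempty T] [Fintype κ] [Finite ι]
    {H : ι → SimpleGraph (Fin 8)} {A : ι → Finset (Fin 8)} (c : κ → ι)
    (hc : Function.Injective c) (hH : ∀ i, H (c i) = sunGraph) (hA : ∀ i, A (c i) = {4, 6})
    (hcard : 2 * Fintype.card T < Fintype.card κ) : ¬ IsHam (glue T H A) := by
  classical
  intro hham
  obtain ⟨σ, hσ, hclosed⟩ := hham.exists_perm
  let g : T × Bool → Option ι := fun p =>
    ((if p.2 then σ (Sum.inl p.1) else σ.symm (Sum.inl p.1)).getRight?).map Prod.fst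
  obtain ⟨i, hi⟩ : ∃ i : κ, ∀ p, g p ≠ some (c i) := by
    by_contra! hcon
    choose f hf using hcon
    have hinj : Function.Injective f := fun i j hij => by
      have := (hf i).symm.trans ((congrArg g hij).trans (hf j))
      exact hc (Option.some_injective _ this)
    have := Fintype.card_le_of_injective f hinj
    simp only [Fintype.card_prod, Fintype.card_bool] at this
    omega
  have hnextT : ∀ a x, σ (Sum.inl a) ≠ Sum.inr (c i, x) := fun a x h =>
    hi (a, true) (by simp [g, h])
  have hprevT : ∀ a x, σ.symm (Sum.inl a) ≠ Sum.inr (c i, x) := fun a x h =>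
    hi (a, false) (by simp [g, h])
  have hnbr : ∀ x, x ≠ 4 → x ≠ 6 → ∀ k y,
      (glue T H A).Adj (Sum.inr (c i, x)) (Sum.inr (k, y)) → k = c i ∧ sunGraph.Adj x y := by
    rintro x h4 h6 k y (⟨rfl, h⟩ | ⟨h, -, -⟩)
    · exact ⟨rfl, hH i ▸ h⟩
    · simp [hA, h4, h6] at h
  refine sunGraph_no_passage (σ := σ) (e := fun x => Sum.inr (c i, x))
    (fun x y h => by simpa using h) (fun X hX h => ?_) (fun x h4 h6 => ?_) (fun x h4 h6 => ?_)
  · obtain ⟨x, hx⟩ := List.exists_mem_of_ne_nil X hX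
    have := hclosed (Set.image (fun x => Sum.inr (c i, x)) {x | x ∈ X}) ⟨_, x, hx, rfl⟩ (by
      rintro _ ⟨z, hz, rfl⟩
      obtain ⟨y, hy, hzy⟩ := h z hz
      exact ⟨y, hy, hzy.symm⟩)
    obtain ⟨y, -, hy⟩ : Sum.inl (Classical.arbitrary T) ∈ _ := this ▸ Set.mem_univ _
    exact Sum.inr_ne_inl hy
  · rcases hu : σ (Sum.inr (c i, x)) with a | ⟨k, y⟩
    · exact absurd (by rw [← hu, Equiv.symm_apply_apply]) (hprevT a x)
    · obtain ⟨rfl, h⟩ := hnbr x h4 h6 k y (hu ▸ hσ _)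
      exact ⟨y, h, rfl⟩
  · rcases hu : σ.symm (Sum.inr (c i, x)) with a | ⟨k, y⟩
    · exact absurd (by rw [← hu, Equiv.apply_symm_apply]) (hnextT a x)
    · have hσy : σ (Sum.inr (k, y)) = Sum.inr (c i, x) := by rw [← hu, Equiv.apply_symm_apply]
      obtain ⟨rfl, h⟩ := hnbr x h4 h6 k y (hσy ▸ hσ _).symm
      exact ⟨y, h, hσy⟩

theorem numComponents_preimage_iso {V V' : Type} {G : SimpleGraph V} {G' : SimpleGraph V'}
    (φ : G ≃g G') (S : Set V') : numComponents G (φ ⁻¹' S) = numComponents G' S := by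
  have ψ : G.induce (φ ⁻¹' S)ᶜ ≃g G'.induce Sᶜ :=
    { toEquiv := φ.toEquiv.subtypeEquiv fun _ => Iff.rfl
      map_rel_iff' := fun {a b} => φ.map_adj_iff }
  exact Nat.card_congr ψ.connectedComponentEquiv

theorem IsTough.iso {V V' : Type} {G : SimpleGraph V} {G' : SimpleGraph V'} {t : ℝ}
    (φ : G ≃g G') (h : IsTough t G) : IsTough t G' := by
  intro S hS
  have hpre : ((S.map φ.symm.toEquiv.toEmbedding : Finset V) : Set V) = φ ⁻¹' S := by
    ext v
    exact Finset.mem_map_equiv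
  have := h (S.map φ.symm.toEquiv.toEmbedding)
  rw [hpre, numComponents_preimage_iso, Finset.card_map] at this
  exact this hS

theorem HasToughness.iso {V V' : Type} {G : SimpleGraph V} {G' : SimpleGraph V'} {t : ℝ}
    (φ : G ≃g G') (h : HasToughness G t) : HasToughness G' t :=
  ⟨⟨h.1.1, h.1.2.iso φ⟩, fun _ hu => h.2 ⟨hu.1, hu.2.iso φ.symm⟩⟩

theorem IsHam.iso {V V' : Type} {G : SimpleGraph V} {G' : SimpleGraph V'} (φ : G ≃g G')
    (h : IsHam G) : IsHam G' := by
  obtain ⟨v, p, hp, hsupp⟩ := h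
  refine ⟨φ v, p.map φ.toHom, hp.map φ.injective, fun u => ?_⟩
  rw [Walk.support_map]
  exact List.mem_map.2 ⟨φ.symm u, hsupp _, φ.apply_symm_apply u⟩

/-- A graph built from `2 * l + 1` copies of `sunGraph` and `j` pendant gadgets around a complete
graph on `l` vertices. The number `k` records how many components each copy of `sunGraph`
contributes to an optimal separation. -/
theorem exists_nonhamiltonian_of_params {t : ℝ} {l j s k : ℕ} (hl : 0 < l) (hs : s ≤ 2)
    (hst : s ≤ t) (hk : (k = 0 ∧ t ≤ 2) ∨ (k = 2 ∧ 2 ≤ t)) (hpos : 0 < (2 * l + 1) * k + j)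
    (heq : t * (1 + (2 * l + 1) * k + j) = l + 2 * ((2 * l + 1) * k) + s * j) :
    ∃ (n : ℕ) (G : SimpleGraph (Fin n)), ¬ IsHam G ∧ HasToughness G t := by
  let ι := Fin (2 * l + 1) ⊕ Fin j
  let H : ι → SimpleGraph (Fin 8) := Sum.elim (fun _ => sunGraph) fun _ => pendantGraph s
  let A : ι → Finset (Fin 8) := Sum.elim (fun _ => {4, 6}) fun _ => {0}ᶜ
  have : Nonempty (Fin l) := ⟨⟨0, hl⟩⟩
  have hham : ¬ IsHam (glue (Fin l) H A) :=
    not_isHam_glue Sum.inl Sum.inl_injective (fun _ => rfl) (fun _ => rfl) (by simp)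
  have htough : HasToughness (glue (Fin l) H A) t := by
    refine hasToughness_glue (c := Sum.elim (fun _ => 2) fun _ => 1)
      (s := Sum.elim (fun _ => 2) fun _ => s) (k := Sum.elim (fun _ => k) fun _ => 1) ?_ ?_
      ((Nat.cast_nonneg s).trans hst) ?_ ?_ ?_
    · rintro (i | i)
      · exact isSparse_sunGraph
      · exact isSparse_pendantGraph hs
    · rintro (i | i)
      · rcases hk with ⟨rfl, -⟩ | ⟨rfl, -⟩
        · exact ⟨∅, ∅, by simp, rfl, by simp, by simp, by simp, 4, by simp [A], by simp⟩
        · exact isTight_sunGraph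
      · exact isTight_pendantGraph hs
    · rintro (i | i) r hr
      · rcases hk with ⟨rfl, ht⟩ | ⟨rfl, ht⟩
        · have : (0 : ℝ) ≤ r := r.cast_nonneg
          simp only [Sum.elim_inl]
          push_cast
          nlinarith
        · have : (r : ℝ) ≤ 2 := by exact_mod_cast hr
          simp only [Sum.elim_inl]
          push_cast
          nlinarith
      · have : (r : ℝ) ≤ 1 := by exact_mod_cast hr
        simp only [Sum.elim_inr]
        push_cast
        nlinarith
    · simpa [ι] using hpos
    · simp only [Fintype.sum_sum_type, Sum.elim_inl, Sum.elim_inr, Finset.sum_const,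
        Finset.card_univ, Fintype.card_fin, nsmul_eq_mul]
      push_cast
      linarith
  let φ := (glue (Fin l) H A).overFinIso rfl
  exact ⟨_, _, fun h => hham (h.iso φ.symm), htough.iso φ⟩

/-- For each rational number `t` with `0 < t < 9/4`, there exists a
nonhamiltonian graph `G` with toughness `τ(G) = t`. -/
theorem toughness_nonhamiltonian (t : ℚ) (h0 : 0 < t) (h1 : t < 9 / 4) :
    ∃ (n : ℕ) (G : SimpleGraph (Fin n)), ¬ IsHam G ∧ HasToughness G (t : ℝ) := by
  obtain ⟨p, hp⟩ : ∃ p : ℕ, t.num = p := Int.eq_ofNat_of_zero_le (Rat.num_pos.2 h0).le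
  have hq : 0 < t.den := t.den_pos
  have htq : (t : ℝ) * t.den = p := by
    have : t * t.den = p := by rw [Rat.mul_den_eq_num, hp]; simp
    exact_mod_cast this
  generalize t.den = q at hq htq
  have hq' : (0 : ℝ) < q := by exact_mod_cast hq
  have ht0 : (0 : ℝ) < t := by exact_mod_cast h0
  have ht1 : (t : ℝ) < 9 / 4 := by
    have := (Rat.cast_lt (K := ℝ)).2 h1
    push_cast at this
    exact this
  have hp0 : 0 < p := by
    have : (0 : ℝ) < p := by rw [← htq]; positivity
    exact_mod_cast this
  have hpq : 4 * p < 9 * q := by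
    have : (4 : ℝ) * p < 9 * q := by rw [← htq]; nlinarith
    exact_mod_cast this
  rcases lt_or_ge (t : ℝ) 1 with ht | ht
  · obtain ⟨j, hj⟩ : ∃ j, 11 * q = j + 1 := ⟨11 * q - 1, by omega⟩
    have hj' : (11 : ℝ) * q = j + 1 := by exact_mod_cast hj
    refine exists_nonhamiltonian_of_params (l := 11 * p) (j := j) (s := 0) (k := 0) (by omega)
      (by omega) (by simpa using ht0.le) (.inl ⟨rfl, by linarith⟩) (by omega) ?_
    push_cast
    linear_combination (-(t : ℝ)) * hj' + 11 * htq
  rcases lt_or_ge (t : ℝ) 2 with ht2 | ht2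
  · have hqp : q ≤ p := by
      have : (q : ℝ) ≤ p := by rw [← htq]; nlinarith
      exact_mod_cast this
    obtain ⟨j, hj⟩ : ∃ j, 11 * q = j + 1 := ⟨11 * q - 1, by omega⟩
    have hj' : (11 : ℝ) * q = j + 1 := by exact_mod_cast hj
    obtain ⟨d, rfl⟩ := Nat.exists_eq_add_of_le hqp
    push_cast at htq
    refine exists_nonhamiltonian_of_params (l := 11 * d + 1) (j := j) (s := 1) (k := 0) (by omega)
      (by omega) (by simpa using ht) (.inl ⟨rfl, by linarith⟩) (by omega) ?_
    push_cast
    linear_combination (1 - (t : ℝ)) * hj' + 11 * htq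
  · have hqp : 2 * q ≤ p := by
      have : (2 : ℝ) * q ≤ p := by rw [← htq]; nlinarith
      exact_mod_cast this
    obtain ⟨d, rfl⟩ := Nat.exists_eq_add_of_le hqp
    obtain ⟨j, hj⟩ : ∃ j, 11 * q = 2 * (2 * (11 * d + 2) + 1) + j + 1 :=
      ⟨11 * q - 2 * (2 * (11 * d + 2) + 1) - 1, by omega⟩
    have hj' : (11 : ℝ) * q = 2 * (2 * (11 * d + 2) + 1) + j + 1 := by exact_mod_cast hj
    push_cast at htq
    refine exists_nonhamiltonian_of_params (l := 11 * d + 2) (j := j) (s := 2) (k := 2) (by omega)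
      le_rfl (by simpa using ht2) (.inr ⟨rfl, ht2⟩) (by omega) ?_
    push_cast
    linear_combination (2 - (t : ℝ)) * hj' + 11 * htq
end

section
/- In the graph L⁽³⁾, the vertices x = w₁ and y = w₅ are not connected by a Hamilton path, i.e., there is no path in L⁽³⁾ with endpoints w₁ and w₅ that contains every vertex of L⁽³⁾. -/
open SimpleGraph

/-- `L⁽³⁾`: obtained from `L⁽¹⁾` by adding a new vertex `w₉ = 8` and the
edges `w₄w₉, w₆w₉`; `x = w₁ = 0`, `y = w₅ = 4`. -/
def L3 : SimpleGraph (Fin 9) := SimpleGraph.fromEdgeSet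
  {s(0,1), s(1,2), s(2,3), s(3,4), s(4,5), s(5,6), s(6,7), s(7,0),
   s(1,3), s(3,5), s(5,7), s(1,7), s(3,8), s(5,8)}

/-- There is a path of length `n` from `u` to `v` whose vertices other than `u` all lie
outside the list `l` of already visited vertices. -/
def HasPathAvoiding {V : Type*} (G : SimpleGraph V) (v : V) : ℕ → List V → V → Prop
  | 0, _, u => u = v
  | n + 1, l, u => ∃ w, G.Adj u w ∧ w ∉ u :: l ∧ HasPathAvoiding G v n (u :: l) w

instance HasPathAvoiding.instDecidable {V : Type*} [Fintype V] [DecidableEq V]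
    (G : SimpleGraph V) [DecidableRel G.Adj] (v : V) :
    ∀ (n : ℕ) (l : List V) (u : V), Decidable (HasPathAvoiding G v n l u)
  | 0, _, u => inferInstanceAs (Decidable (u = v))
  | n + 1, l, u =>
    have := HasPathAvoiding.instDecidable G v n
    inferInstanceAs (Decidable (∃ w, G.Adj u w ∧ w ∉ u :: l ∧ HasPathAvoiding G v n (u :: l) w))

theorem SimpleGraph.Walk.IsPath.hasPathAvoiding {V : Type*} {G : SimpleGraph V} {u v : V}
    {p : G.Walk u v} (hp : p.IsPath) {l : List V} (hl : ∀ w ∈ p.support, w ∉ l) :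
    HasPathAvoiding G v p.length l u := by
  induction p generalizing l with
  | nil => rfl
  | @cons u w v h q ih =>
    rw [Walk.cons_isPath_iff] at hp
    have hq : ∀ z ∈ q.support, z ∉ u :: l := by
      intro z hz hzl
      rcases List.mem_cons.mp hzl with rfl | hzl
      · exact hp.2 hz
      · exact hl z (by simp [hz]) hzl
    exact ⟨w, h, hq w q.start_mem_support, ih hp.1 hq⟩

/-- A Hamilton path has one edge fewer than the graph has vertices. -/
theorem SimpleGraph.Walk.IsPath.length_add_one_eq_card {V : Type*} [Fintype V]
    {G : SimpleGraph V} {u v : V} {p : G.Walk u v} (hp : p.IsPath)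
    (hall : ∀ w, w ∈ p.support) : p.length + 1 = Fintype.card V := by
  classical
  rw [← p.length_support, ← List.toFinset_card_of_nodup hp.support_nodup,
    Finset.card_eq_iff_eq_univ]
  ext w
  simp [hall w]

instance L3.instDecidableAdj : DecidableRel L3.Adj := by
  unfold L3
  infer_instance

/-- The vertices `x = w₁` and `y = w₅` are not connected by a Hamilton path
of `L⁽³⁾`. -/
theorem no_ham_path_L3 : ¬ HamConnected L3 0 4 := by
  rintro ⟨p, hp, hall⟩
  have hlen : p.length = 8 := by
    simpa using hp.length_add_one_eq_card hall
  have hext : HasPathAvoiding L3 4 p.length [] 0 := hp.hasPathAvoiding (by simp)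
  rw [hlen] at hext
  revert hext
  decide +kernel
end
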